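/- arXiv:0811.0402 — 2 statements merged into one kernel-verified Lean document; each statement's English description precedes it below -/
import Mathlib

section
/- Let n ≥ 2 and let M be a symmetric (n+1)×(n+1) matrix over a commutative ring R, and assume that I_{n−1} does not lie in the ideal of R generated by I_n. Then I_{n−1}·G_n − (Li_n)² lies in the ideal of R generated by I_n, i.e. I_{n−1}·G_n ≡ (Li_n)² (mod I_n). -/
open Matrix

/-- The strictly monotone map `Fin (m-1) → Fin m` whose image avoids exactly the value `i`. -/
def skipAt {m : ℕ} (i : Fin m) (x : Fin (m-1)) : Fin m :=
  if (x : ℕ) < (i : ℕ) then ⟨(x : ℕ), by have := x.isLt; omega⟩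
  else ⟨(x : ℕ) + 1, by have := x.isLt; omega⟩

/-- The top-left `n × n` block `A` of an `(n+1) × (n+1)` matrix `M`;
its determinant is `I_n`. -/
def topSq {R : Type*} [CommRing R] {n : ℕ} (M : Matrix (Fin (n+1)) (Fin (n+1)) R) :
    Matrix (Fin n) (Fin n) R :=
  M.submatrix Fin.castSucc Fin.castSucc

/-- The border entries `a_i := M_{i,n}` for `0 ≤ i ≤ n-1`. -/
def borderCoeff {R : Type*} [CommRing R] {n : ℕ} (M : Matrix (Fin (n+1)) (Fin (n+1)) R)
    (i : Fin n) : R :=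
  M i.castSucc (Fin.last n)

/-- `I_{n-1}`: the determinant of the top-left `(n-1) × (n-1)` block of `M`. -/
def Iprev {R : Type*} [CommRing R] {n : ℕ} (M : Matrix (Fin (n+1)) (Fin (n+1)) R) : R :=
  (M.submatrix (fun x : Fin (n-1) => (⟨(x : ℕ), by have := x.isLt; omega⟩ : Fin (n+1)))
     (fun x : Fin (n-1) => (⟨(x : ℕ), by have := x.isLt; omega⟩ : Fin (n+1)))).det

/-- The inclusion `Fin (n-1) → Fin n`. -/
def finCastPred {n : ℕ} (i : Fin (n-1)) : Fin n := ⟨(i : ℕ), by have := i.isLt; omega⟩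

/-- `G_n := Σ_{0 ≤ i,j ≤ n-1} (-1)^{i+j} a_i a_j I_n(i;j)`, where `I_n(i;j)` is the
determinant of the top-left `n × n` block with row `i` and column `j` deleted. -/
def Gpoly {R : Type*} [CommRing R] {n : ℕ} (M : Matrix (Fin (n+1)) (Fin (n+1)) R) : R :=
  ∑ i : Fin n, ∑ j : Fin n, (-1 : R) ^ ((i : ℕ) + (j : ℕ))
    * borderCoeff M i * borderCoeff M j
    * ((topSq M).submatrix (skipAt i) (skipAt j)).det

/-- `Li_n := a_{n-1} I_{n-1} + Σ_{i=0}^{n-2} (-1)^{i+n-1} a_i I_n(i;n-1)`. -/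
def LiL {R : Type*} [CommRing R] {n : ℕ} (M : Matrix (Fin (n+1)) (Fin (n+1)) R)
    (hn : 1 ≤ n) : R :=
  borderCoeff M ⟨n-1, by omega⟩ * Iprev M
    + ∑ i : Fin (n-1), (-1 : R) ^ ((i : ℕ) + (n-1))
        * borderCoeff M (finCastPred i)
        * ((topSq M).submatrix (skipAt (finCastPred i)) (skipAt (⟨n-1, by omega⟩ : Fin n))).det

/-- `Li'_n := a_{n-1} I_{n-1} + Σ_{j=0}^{n-2} (-1)^{j+n-1} a_j I_n(n-1;j)`. -/
def LiR {R : Type*} [CommRing R] {n : ℕ} (M : Matrix (Fin (n+1)) (Fin (n+1)) R)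
    (hn : 1 ≤ n) : R :=
  borderCoeff M ⟨n-1, by omega⟩ * Iprev M
    + ∑ j : Fin (n-1), (-1 : R) ^ ((j : ℕ) + (n-1))
        * borderCoeff M (finCastPred j)
        * ((topSq M).submatrix (skipAt (⟨n-1, by omega⟩ : Fin n)) (skipAt (finCastPred j))).det

theorem skipAt_eq_succAbove {m : ℕ} (i : Fin (m + 1)) :
    (skipAt i : Fin m → Fin (m + 1)) = i.succAbove := by
  funext x
  unfold skipAt
  by_cases h : (x : ℕ) < (i : ℕ)
  · rw [if_pos h, Fin.succAbove_of_castSucc_lt _ _ h]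
    rfl
  · rw [if_neg h, Fin.succAbove_of_le_castSucc _ _ (not_lt.mp h)]
    rfl

/-- The Plücker relation for the columns of `A` together with two further vectors. -/
theorem cramer_mul_cramer_sub {R ι : Type*} [CommRing R] [Fintype ι] [DecidableEq ι]
    (A : Matrix ι ι R) (u v : ι → R) {i j : ι} (hij : i ≠ j) :
    A.cramer u i * A.cramer v j - A.cramer v i * A.cramer u j =
      A.det * ((A.updateCol j v).updateCol i u).det := by
  have hu : A.det • u = ∑ c, A.cramer u c • A.col c := by
    rw [← Matrix.mulVec_cramer, Matrix.mulVec_eq_sum]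
    simp [Matrix.col_def]
  have hexp : A.det * ((A.updateCol j v).updateCol i u).det =
      ∑ c, A.cramer u c * (A.updateCol j v).cramer (A.col c) i := by
    rw [← Matrix.cramer_apply, ← smul_eq_mul, ← Pi.smul_apply, ← map_smul, hu, map_sum,
      Finset.sum_apply]
    simp only [map_smul, Pi.smul_apply, smul_eq_mul]
  have hi : (A.updateCol j v).cramer (A.col i) i = A.cramer v j := by
    rw [Matrix.cramer_apply, Matrix.cramer_apply]
    congr 1
    ext r c
    by_cases hc : c = i
    · subst hc; simp [hij]
    · simp [Matrix.updateCol_apply, hc]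
  have hj : (A.updateCol j v).cramer (A.col j) i = -A.cramer v i := by
    rw [Matrix.cramer_apply, Matrix.cramer_apply]
    have hswap := Matrix.det_permute' (Equiv.swap i j) (A.updateCol i v)
    rw [Equiv.Perm.sign_swap hij] at hswap
    simp only [Units.val_neg, Units.val_one, Int.cast_neg, Int.cast_one, neg_mul, one_mul]
      at hswap
    rw [← hswap]
    congr 1
    ext r c
    by_cases hc : c = i
    · subst hc; simp [hij.symm]
    · by_cases hc' : c = j
      · subst hc'; simp [hc]
      · simp [hc, hc', Equiv.swap_apply_of_ne_of_ne hc hc']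
  have hne : ∀ c, c ≠ i ∧ c ≠ j → A.cramer u c * (A.updateCol j v).cramer (A.col c) i = 0 := by
    rintro c ⟨hci, hcj⟩
    rw [Matrix.cramer_apply (A.updateCol j v), Matrix.det_zero_of_column_eq hci, mul_zero]
    intro r
    simp [hci, hcj]
  rw [hexp, Fintype.sum_eq_add i j hij hne, hi, hj]
  ring

theorem cramer_mul_cramer_sub_mem_span_det {R ι : Type*} [CommRing R] [Fintype ι]
    [DecidableEq ι] (A : Matrix ι ι R) (u v : ι → R) (i j : ι) :
    A.cramer u i * A.cramer v j - A.cramer v i * A.cramer u j ∈ Ideal.span {A.det} := by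
  rcases eq_or_ne i j with rfl | hij
  · rw [mul_comm, sub_self]
    exact zero_mem _
  · rw [cramer_mul_cramer_sub A u v hij]
    exact Ideal.mul_mem_right _ _ (Ideal.mem_span_singleton_self _)

/-- The `2 × 2` minors of the adjugate vanish modulo the determinant, stated for the bilinear
form of the adjugate. -/
theorem adjugate_mul_dotProduct_sub_mem_span_det {R ι : Type*} [CommRing R] [Fintype ι]
    [DecidableEq ι] (A : Matrix ι ι R) (b w : ι → R) (l : ι) :
    A.adjugate l l * (w ⬝ᵥ A.adjugate *ᵥ b) - (A.adjugate *ᵥ b) l * (w ᵥ* A.adjugate) l ∈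
      Ideal.span {A.det} := by
  have hsum : A.adjugate l l * (w ⬝ᵥ A.adjugate *ᵥ b) - (A.adjugate *ᵥ b) l * (w ᵥ* A.adjugate) l =
      ∑ j, w j * (A.cramer (Pi.single l 1) l * A.cramer b j -
        A.cramer b l * A.cramer (Pi.single l 1) j) := by
    simp only [Matrix.cramer_eq_adjugate_mulVec, Matrix.mulVec_single_one, Matrix.col_apply,
      Matrix.vecMul, dotProduct, Finset.mul_sum, ← Finset.sum_sub_distrib]
    exact Finset.sum_congr rfl fun j _ => by ring
  rw [hsum]
  exact sum_mem fun j _ => Ideal.mul_mem_left _ _ (cramer_mul_cramer_sub_mem_span_det A _ _ _ _)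

theorem Iprev_eq_adjugate {R : Type*} [CommRing R] {m : ℕ}
    (M : Matrix (Fin (m + 1 + 1)) (Fin (m + 1 + 1)) R) :
    Iprev M = (topSq M).adjugate (Fin.last m) (Fin.last m) := by
  rw [Matrix.adjugate_fin_succ_eq_det_submatrix, Even.neg_one_pow ⟨_, rfl⟩, one_mul,
    Fin.succAbove_last]
  rfl

theorem Gpoly_eq_dotProduct {R : Type*} [CommRing R] {m : ℕ}
    (M : Matrix (Fin (m + 1 + 1)) (Fin (m + 1 + 1)) R) :
    Gpoly M = borderCoeff M ⬝ᵥ (topSq M)ᵀ.adjugate *ᵥ borderCoeff M := by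
  simp only [Gpoly, dotProduct, Matrix.mulVec, Finset.mul_sum, ← Matrix.adjugate_transpose,
    Matrix.transpose_apply]
  refine Finset.sum_congr rfl fun i _ => Finset.sum_congr rfl fun j _ => ?_
  rw [Matrix.adjugate_fin_succ_eq_det_submatrix, ← skipAt_eq_succAbove, ← skipAt_eq_succAbove]
  change _ = _ * ((-1) ^ _ * (Matrix.submatrix (topSq M) (skipAt i) (skipAt j)).det * _)
  ring

theorem LiL_eq_mulVec {R : Type*} [CommRing R] {m : ℕ}
    (M : Matrix (Fin (m + 1 + 1)) (Fin (m + 1 + 1)) R) (hn : 1 ≤ m + 1) :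
    LiL M hn = ((topSq M).adjugate *ᵥ borderCoeff M) (Fin.last m) := by
  have hlast : borderCoeff M (Fin.last m) * Iprev M =
      (topSq M).adjugate (Fin.last m) (Fin.last m) * borderCoeff M (Fin.last m) := by
    rw [Iprev_eq_adjugate, mul_comm]
  have hcast (i : Fin m) : (-1 : R) ^ ((i : ℕ) + m) * borderCoeff M i.castSucc *
      ((topSq M).submatrix (skipAt i.castSucc) (skipAt (Fin.last m))).det =
        (topSq M).adjugate (Fin.last m) i.castSucc * borderCoeff M i.castSucc := by
    rw [Matrix.adjugate_fin_succ_eq_det_submatrix, ← skipAt_eq_succAbove, ← skipAt_eq_succAbove]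
    exact mul_right_comm _ _ _
  rw [Matrix.mulVec, dotProduct, Fin.sum_univ_castSucc]
  refine Eq.trans ?_ (add_comm _ _)
  exact congrArg₂ (· + ·) hlast (Finset.sum_congr rfl fun i _ => hcast i)

/-- Corollary 1.4: for a symmetric matrix, if `I_{n-1} ≢ 0 (mod I_n)`, then
`I_{n-1}·G_n ≡ (Li_n)² (mod I_n)`. -/
theorem Iprev_mul_Gpoly_congr_sq {R : Type*} [CommRing R] {n : ℕ} (hn : 2 ≤ n)
    (M : Matrix (Fin (n+1)) (Fin (n+1)) R) (hsym : M.IsSymm)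
    (hmem : Iprev M ∉ Ideal.span {(topSq M).det}) :
    Iprev M * Gpoly M - (LiL M (by omega)) ^ 2 ∈ Ideal.span {(topSq M).det} := by
  obtain ⟨m, rfl⟩ : ∃ m, n = m + 1 := ⟨n - 1, by omega⟩
  have hA : (topSq M)ᵀ = topSq M := hsym.submatrix _
  have hvec : borderCoeff M ᵥ* (topSq M).adjugate = (topSq M).adjugate *ᵥ borderCoeff M := by
    rw [← Matrix.mulVec_transpose, Matrix.adjugate_transpose, hA]
  have h := adjugate_mul_dotProduct_sub_mem_span_det (topSq M) (borderCoeff M) (borderCoeff M)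
    (Fin.last m)
  rw [hvec] at h
  rw [Iprev_eq_adjugate, Gpoly_eq_dotProduct, LiL_eq_mulVec, hA, sq]
  exact h
end

section
/- Let Γ be a connected primitively log divergent simple graph with at least one edge. Then every vertex of Γ has degree at least 3. -/
/-- The first Betti number `h₁(G) = |E(G)| − |V(G)| + c(G)` of a finite simple graph. -/
noncomputable def betti {V : Type*} (G : SimpleGraph V) : ℤ :=
  (Nat.card G.edgeSet : ℤ) - (Nat.card V : ℤ) + (Nat.card G.ConnectedComponent : ℤ)

/-- The set of endpoints of the edges in `F`. -/
def edgeSupport {V : Type*} (F : Set (Sym2 V)) : Set V := {v : V | ∃ e ∈ F, v ∈ e}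

/-- The subgraph spanned by a set of edges `F`: its edge set is `F` and its vertex set
is the set of endpoints of edges in `F`. -/
def spannedSubgraph {V : Type*} (F : Set (Sym2 V)) : SimpleGraph (edgeSupport F) :=
  (SimpleGraph.fromEdgeSet F).induce (edgeSupport F)

/-- `h₁(G_F) = |F| − |V(G_F)| + c(G_F)` for the subgraph spanned by `F`. -/
noncomputable def bettiOfEdges {V : Type*} (F : Set (Sym2 V)) : ℤ :=
  (Nat.card F : ℤ) - (Nat.card (edgeSupport F) : ℤ)
    + (Nat.card (spannedSubgraph F).ConnectedComponent : ℤ)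

/-- The subgraph spanned by `F` is convergent: `|E| > 2·h₁`. -/
def ConvergentEdges {V : Type*} (F : Set (Sym2 V)) : Prop :=
  2 * bettiOfEdges F < (Nat.card F : ℤ)

/-- A graph is logarithmically divergent if `|E(G)| = 2·h₁(G)`. -/
def LogDivergent {V : Type*} (G : SimpleGraph V) : Prop :=
  (Nat.card G.edgeSet : ℤ) = 2 * betti G

/-- A graph is primitively log divergent if it is logarithmically divergent and the
subgraph spanned by every nonempty proper subset of its edges which is connected is
convergent. -/
def PrimLogDivergent {V : Type*} (G : SimpleGraph V) : Prop :=
  LogDivergent G ∧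
    ∀ F : Set (Sym2 V), F ⊆ G.edgeSet → F.Nonempty → F ≠ G.edgeSet →
      (spannedSubgraph F).Connected → ConvergentEdges F

/-- The edges of `G` with both endpoints in `S`. -/
def edgesWithin {V : Type*} (G : SimpleGraph V) (S : Set V) : Set (Sym2 V) :=
  {e | e ∈ G.edgeSet ∧ ∀ v ∈ e, v ∈ S}

theorem edgeSupport_edgesWithin_subset {V : Type*} (G : SimpleGraph V) (S : Set V) :
    edgeSupport (edgesWithin G S) ⊆ S := by
  rintro v ⟨e, he, hv⟩
  exact he.2 v hv

theorem edgeSupport_edgesWithin {V : Type*} (G : SimpleGraph V) (S : Set V)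
    (hc : (G.induce S).Connected) (hS : S.Nontrivial) :
    edgeSupport (edgesWithin G S) = S := by
  refine (edgeSupport_edgesWithin_subset G S).antisymm fun v hv => ?_
  have : Nontrivial S := hS.coe_sort
  obtain ⟨w, hw⟩ := hc.preconnected.exists_adj_of_nontrivial ⟨v, hv⟩
  refine ⟨s(v, w), ⟨hw, fun x hx => ?_⟩, Sym2.mem_mk_left _ _⟩
  rcases Sym2.mem_iff.1 hx with rfl | rfl
  · exact hv
  · exact w.2

theorem spannedSubgraph_edgesWithin_connected {V : Type*} (G : SimpleGraph V) (S : Set V)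
    (hc : (G.induce S).Connected) (hS : S.Nontrivial) :
    (spannedSubgraph (edgesWithin G S)).Connected := by
  have key : (SimpleGraph.fromEdgeSet (edgesWithin G S)).induce S = G.induce S := by
    ext a b
    simp only [SimpleGraph.comap_adj, Function.Embedding.subtype_apply,
      SimpleGraph.fromEdgeSet_adj]
    refine ⟨fun h => h.1.1, fun h => ⟨⟨h, fun x hx => ?_⟩, h.ne⟩⟩
    rcases Sym2.mem_iff.1 hx with rfl | rfl
    · exact a.2
    · exact b.2
  rw [spannedSubgraph, edgeSupport_edgesWithin G S hc hS, key]
  exact hc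

theorem SimpleGraph.Connected.card_connectedComponent {V : Type*} {G : SimpleGraph V}
    (h : G.Connected) : Nat.card G.ConnectedComponent = 1 := by
  have := h.preconnected.subsingleton_connectedComponent
  have := h.nonempty
  have : Nonempty G.ConnectedComponent := ⟨G.connectedComponentMk (Classical.arbitrary V)⟩
  exact Nat.card_eq_one_iff_unique.2 ⟨inferInstance, inferInstance⟩

theorem edgesWithin_eq_empty {V : Type*} (G : SimpleGraph V) {S : Set V}
    (hS : S.Subsingleton) : edgesWithin G S = ∅ := by
  refine Set.eq_empty_of_forall_notMem fun e => ?_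
  induction e with
  | h a b =>
    rintro ⟨he, h⟩
    exact G.ne_of_adj he (hS (h a (Sym2.mem_mk_left _ _)) (h b (Sym2.mem_mk_right _ _)))

theorem ncard_edgesWithin_of_connected {V : Type*} [Finite V] {G : SimpleGraph V}
    (hconn : G.Connected) (hpld : PrimLogDivergent G) {S : Set V}
    (hS : S.Nontrivial) (hne : S ≠ Set.univ) (hc : (G.induce S).Connected) :
    (edgesWithin G S).ncard + 3 ≤ 2 * S.ncard := by
  have hsupp := edgeSupport_edgesWithin G S hc hS
  have hcon := spannedSubgraph_edgesWithin_connected G S hc hS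
  have hnonempty : (edgesWithin G S).Nonempty := by
    obtain ⟨v, hv⟩ := hS.nonempty
    rw [← hsupp] at hv
    obtain ⟨e, he, -⟩ := hv
    exact ⟨e, he⟩
  have hproper : edgesWithin G S ≠ G.edgeSet := by
    intro h
    obtain ⟨v, hv⟩ := (Set.ne_univ_iff_exists_notMem S).1 hne
    obtain ⟨a, -, b, -, hab⟩ := hS
    have : Nontrivial V := ⟨a, b, hab⟩
    obtain ⟨w, hw⟩ := hconn.preconnected.exists_adj_of_nontrivial v
    have hmem : s(v, w) ∈ edgesWithin G S := h ▸ hw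
    exact hv (hmem.2 v (Sym2.mem_mk_left _ _))
  have hconv := hpld.2 _ (fun e he => he.1) hnonempty hproper hcon
  rw [ConvergentEdges, bettiOfEdges, hcon.card_connectedComponent, hsupp,
    Nat.card_coe_set_eq, Nat.card_coe_set_eq] at hconv
  omega

theorem edgesWithin_subset_union {V : Type*} (G : SimpleGraph V) {S A B : Set V}
    (hAB : S ⊆ A ∪ B) (h : ∀ a ∈ A, ∀ b ∈ B, ¬ G.Adj a b) :
    edgesWithin G S ⊆ edgesWithin G A ∪ edgesWithin G B := by
  intro e
  induction e with
  | h a b =>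
    rintro ⟨he, hm⟩
    have hadj : G.Adj a b := he
    have ha := hAB (hm a (Sym2.mem_mk_left _ _))
    have hb := hAB (hm b (Sym2.mem_mk_right _ _))
    rcases ha with ha | ha <;> rcases hb with hb | hb
    · exact Or.inl ⟨he, by simp [ha, hb]⟩
    · exact absurd hadj (h a ha b hb)
    · exact absurd hadj.symm (h b hb a ha)
    · exact Or.inr ⟨he, by simp [ha, hb]⟩

theorem exists_separation_of_not_connected {V : Type*} (G : SimpleGraph V) {S : Set V}
    (hS : S.Nonempty) (hc : ¬ (G.induce S).Connected) :
    ∃ A ⊆ S, A.Nonempty ∧ (S \ A).Nonempty ∧ ∀ a ∈ A, ∀ b ∈ S \ A, ¬ G.Adj a b := by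
  have hp : ¬ (G.induce S).Preconnected := fun h => hc
    ((SimpleGraph.connected_iff _).2 ⟨h, hS.to_subtype⟩)
  simp only [SimpleGraph.Preconnected, not_forall] at hp
  obtain ⟨a, b, hab⟩ := hp
  refine ⟨{x | ∃ hx : x ∈ S, (G.induce S).Reachable a ⟨x, hx⟩}, fun x hx => hx.1,
    ⟨a, a.2, SimpleGraph.Reachable.refl _⟩, ⟨b, b.2, fun h => hab h.2⟩, ?_⟩
  rintro x ⟨hx, hax⟩ y ⟨hy, hay⟩ hxy
  have hadj : (G.induce S).Adj ⟨x, hx⟩ ⟨y, hy⟩ := hxy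
  exact hay ⟨hy, hax.trans hadj.reachable⟩

/-- A proper vertex set with at least two elements of a connected primitively log divergent
graph spans few edges, whether or not it induces a connected subgraph. -/
theorem ncard_edgesWithin_add_three_le {V : Type*} [Finite V] {G : SimpleGraph V}
    (hconn : G.Connected) (hpld : PrimLogDivergent G) (S : Set V)
    (hS : S.Nontrivial) (hne : S ≠ Set.univ) :
    (edgesWithin G S).ncard + 3 ≤ 2 * S.ncard := by
  induction hn : S.ncard using Nat.strong_induction_on generalizing S with
  | h n ih =>
    subst hn
    by_cases hc : (G.induce S).Connected
    · exact ncard_edgesWithin_of_connected hconn hpld hS hne hc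
    · have bound : ∀ T : Set V, T ⊂ S → T.Nonempty →
          (edgesWithin G T).ncard + 2 ≤ 2 * T.ncard := by
        intro T hT hTne
        rcases T.subsingleton_or_nontrivial with h | h
        · rw [edgesWithin_eq_empty G h, Set.ncard_empty]
          have := hTne.ncard_pos
          omega
        · have := ih _ (Set.ncard_lt_ncard hT) T h
            (fun hu => hT.2 (hu ▸ Set.subset_univ S)) rfl
          omega
      obtain ⟨A, hAS, hA, hB, hAB⟩ := exists_separation_of_not_connected G hS.nonempty hc
      have h1 := bound A ⟨hAS, fun h => hB.elim fun x hx => hx.2 (h hx.1)⟩ hA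
      have h2 := bound (S \ A)
        ⟨Set.sdiff_subset, fun h => hA.elim fun x hx => (h (hAS hx)).2 hx⟩ hB
      have h3 := Set.ncard_le_ncard
        (edgesWithin_subset_union G (Set.union_sdiff_cancel hAS).superset hAB)
      have h4 := Set.ncard_union_le (edgesWithin G A) (edgesWithin G (S \ A))
      have h5 := Set.ncard_sdiff_add_ncard_of_subset hAS
      omega

theorem ncard_edgeSet_le_add_degree {V : Type*} [Fintype V] (G : SimpleGraph V)
    [DecidableRel G.Adj] (v : V) :
    G.edgeSet.ncard ≤ (edgesWithin G {v}ᶜ).ncard + G.degree v := by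
  classical
  have hsub : G.edgeSet ⊆ edgesWithin G {v}ᶜ ∪ G.incidenceSet v := by
    intro e he
    by_cases hv : v ∈ e
    · exact Or.inr ⟨he, hv⟩
    · exact Or.inl ⟨he, fun x hx hxv => hv (hxv ▸ hx)⟩
  have hdeg : (G.incidenceSet v).ncard = G.degree v := by
    rw [← Nat.card_coe_set_eq, Nat.card_eq_fintype_card, G.card_incidenceSet_eq_degree]
  rw [← hdeg]
  exact (Set.ncard_le_ncard hsub).trans (Set.ncard_union_le _ _)

/-- Lemma 3.1.2: every vertex of a connected primitively log divergent simple graph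
(with at least one edge) has degree at least `3`. -/
theorem three_le_degree_of_primLogDivergent {V : Type*} [Fintype V]
    (G : SimpleGraph V) [DecidableRel G.Adj]
    (hconn : G.Connected) (hne : G.edgeSet.Nonempty)
    (hpld : PrimLogDivergent G) (v : V) :
    3 ≤ G.degree v := by
  classical
  have hlog := hpld.1
  rw [LogDivergent, betti, hconn.card_connectedComponent, Nat.card_coe_set_eq] at hlog
  have hpos := hne.ncard_pos
  have hchoose : G.edgeSet.ncard ≤ (Nat.card V).choose 2 := by
    rw [← SimpleGraph.coe_edgeFinset, Set.ncard_coe_finset, Nat.card_eq_fintype_card]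
    exact G.card_edgeFinset_le_card_choose_two
  have hcard : 3 ≤ Nat.card V := by
    by_contra! hlt
    interval_cases Nat.card V <;> simp only [Nat.choose] at hchoose <;> omega
  have hcompl := Set.ncard_add_ncard_compl ({v} : Set V)
  rw [Set.ncard_singleton] at hcompl
  have hnt : ({v}ᶜ : Set V).Nontrivial := by
    rw [← Set.one_lt_ncard_iff_nontrivial]
    omega
  have hbound := ncard_edgesWithin_add_three_le hconn hpld {v}ᶜ hnt (by simp)
  have hdeg := ncard_edgeSet_le_add_degree G v
  omega
end
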